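/- Dual quadrilinear estimate in ℝ^{2+1}. Let s ∈ (4/7, 1) and let ε > 0 be sufficiently small. There is a constant C = C(s, ε) such that for all Schwartz functions φ₁, φ₂, φ₃, φ₄ on ℝ² × ℝ, |∫_ℝ ∫_{ℝ²} (⟨∇⟩^s φ₁)(x,t) · conj(φ₂)(x,t) · φ₃(x,t) · φ₄(x,t) dx dt| ≤ C ‖φ₁‖_{X_{s, 1/2+ε}} ‖φ₂‖_{X_{s, 1/2+ε}} ‖φ₃‖_{X_{s, 1/2+ε}} ‖φ₄‖_{X_{0, 1/2−2ε}}. -/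

import Mathlib

open MeasureTheory Complex Set
open scoped FourierTransform BigOperators RealInnerProductSpace

noncomputable section

abbrev Rn (n : ℕ) := EuclideanSpace ℝ (Fin n)

/-- Japanese bracket of a vector. -/
def jap {n : ℕ} (ξ : Rn n) : ℝ := Real.sqrt (1 + ‖ξ‖ ^ 2)

/-- Japanese bracket of a real number. -/
def japR (x : ℝ) : ℝ := Real.sqrt (1 + x ^ 2)

/-- Inhomogeneous Sobolev norm ‖⟨ξ⟩^s f̂‖_{L²}. -/
def sobNorm (n : ℕ) (s : ℝ) (f : Rn n → ℂ) : ℝ :=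
  (∫ ξ : Rn n, jap ξ ^ (2 * s) * ‖𝓕 f ξ‖ ^ 2) ^ (1/2 : ℝ)

/-- Homogeneous Sobolev norm ‖|ξ|^s f̂‖_{L²}. -/
def sobNormHom (n : ℕ) (s : ℝ) (f : Rn n → ℂ) : ℝ :=
  (∫ ξ : Rn n, ‖ξ‖ ^ (2 * s) * ‖𝓕 f ξ‖ ^ 2) ^ (1/2 : ℝ)

/-- L^p norm on ℝⁿ. -/
def lpNorm (n : ℕ) (p : ℝ) (f : Rn n → ℂ) : ℝ :=
  (∫ x : Rn n, ‖f x‖ ^ p) ^ (1/p)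

/-- Laplacian: sum of second partial derivatives. -/
def laplacian {n : ℕ} (f : Rn n → ℂ) (x : Rn n) : ℂ :=
  ∑ i : Fin n, fderiv ℝ (fun y => fderiv ℝ f y (EuclideanSpace.single i 1)) x
    (EuclideanSpace.single i 1)

/-- Complex gradient as a vector in Euclidean space. -/
def gradC {n : ℕ} (f : Rn n → ℂ) (x : Rn n) : EuclideanSpace ℂ (Fin n) :=
  (WithLp.equiv 2 (Fin n → ℂ)).symm fun i => fderiv ℝ f x (EuclideanSpace.single i 1)

/-- φ is a solution of the cubic defocussing NLS on ℝⁿ × [0,T] with data φ₀: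
smooth, Schwartz in x uniformly for t ∈ [0,T] (with all derivatives),
satisfying i∂ₜφ + Δφ = |φ|²φ and φ(·,0) = φ₀. -/
def IsNLSSolution (n : ℕ) (T : ℝ) (φ : Rn n → ℝ → ℂ) (φ₀ : Rn n → ℂ) : Prop :=
  ContDiff ℝ (⊤ : ℕ∞) (fun p : Rn n × ℝ => φ p.1 p.2) ∧
  (∀ k l : ℕ, ∃ C : ℝ, ∀ t ∈ Icc (0:ℝ) T, ∀ x : Rn n,
      ‖x‖ ^ k * ‖iteratedFDeriv ℝ l (fun y => φ y t) x‖ ≤ C) ∧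
  (∀ x : Rn n, ∀ t ∈ Icc (0:ℝ) T,
      Complex.I * deriv (fun t' => φ x t') t + laplacian (fun y => φ y t) x
        = (‖φ x t‖ : ℂ) ^ 2 * φ x t) ∧
  (∀ x : Rn n, φ x 0 = φ₀ x)

/-- The energy E(f) = ∫ (1/2)|∇f|² + (1/4)|f|⁴. -/
def energy {n : ℕ} (f : Rn n → ℂ) : ℝ :=
  ∫ x : Rn n, ((1/2 : ℝ) * ∑ i : Fin n, ‖fderiv ℝ f x (EuclideanSpace.single i 1)‖ ^ 2
    + (1/4 : ℝ) * ‖f x‖ ^ 4)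

/-- m₁ is a smooth, radially symmetric, nonincreasing multiplier with
m₁ = 1 on the unit ball, m₁(ξ) = |ξ|^{-(1-s)} for |ξ| ≥ 2, 0 < m₁ ≤ 1. -/
def IsAdmissibleMultiplier (n : ℕ) (s : ℝ) (m₁ : Rn n → ℝ) : Prop :=
  ContDiff ℝ (⊤ : ℕ∞) m₁ ∧
  (∀ ξ : Rn n, 0 < m₁ ξ ∧ m₁ ξ ≤ 1) ∧
  (∀ ξ η : Rn n, ‖ξ‖ = ‖η‖ → m₁ ξ = m₁ η) ∧
  (∀ ξ η : Rn n, ‖ξ‖ ≤ ‖η‖ → m₁ η ≤ m₁ ξ) ∧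
  (∀ ξ : Rn n, ‖ξ‖ ≤ 1 → m₁ ξ = 1) ∧
  (∀ ξ : Rn n, 2 ≤ ‖ξ‖ → m₁ ξ = ‖ξ‖ ^ (-(1 - s)))

/-- The rescaled multiplier m_N(ξ) = m₁(ξ/N). -/
def mN {n : ℕ} (m₁ : Rn n → ℝ) (N : ℝ) (ξ : Rn n) : ℝ := m₁ (N⁻¹ • ξ)

/-- The smoothing operator I_N with Fourier multiplier m_N. -/
def Iop {n : ℕ} (m₁ : Rn n → ℝ) (N : ℝ) (f : Rn n → ℂ) : Rn n → ℂ :=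
  fun x => 𝓕⁻ (fun ξ => (mN m₁ N ξ : ℂ) * 𝓕 f ξ) x

/-- The spatial multiplier ⟨∇⟩^s. -/
def japMul (n : ℕ) (s : ℝ) (f : Rn n → ℂ) : Rn n → ℂ :=
  fun x => 𝓕⁻ (fun ξ => ((jap ξ ^ s : ℝ) : ℂ) * 𝓕 f ξ) x

/-- Sharp Littlewood–Paley projection onto {M ≤ ⟨ξ⟩ ≤ 2M}. -/
def LP (n : ℕ) (M : ℝ) (f : Rn n → ℂ) : Rn n → ℂ :=
  fun x => 𝓕⁻ (fun ξ => if M ≤ jap ξ ∧ jap ξ ≤ 2 * M then 𝓕 f ξ else 0) x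

/-- Space-time Fourier transform ψ̃(ξ,τ). -/
def stFourier (n : ℕ) {E : Type*} [NormedAddCommGroup E] [NormedSpace ℂ E]
    (ψ : Rn n → ℝ → E) (ξ : Rn n) (τ : ℝ) : E :=
  ∫ x : Rn n, ∫ t : ℝ,
    Complex.exp (Complex.I * ((-2 * Real.pi * (⟪x, ξ⟫ + t * τ) : ℝ) : ℂ)) • ψ x t

/-- The X_{s,b} norm ‖⟨ξ⟩^s ⟨τ-|ξ|²⟩^b ψ̃‖_{L²}. -/
def XNorm (n : ℕ) {E : Type*} [NormedAddCommGroup E] [NormedSpace ℂ E]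
    (s b : ℝ) (ψ : Rn n → ℝ → E) : ℝ :=
  (∫ ξ : Rn n, ∫ τ : ℝ,
    jap ξ ^ (2 * s) * japR (τ - ‖ξ‖ ^ 2) ^ (2 * b) * ‖stFourier n ψ ξ τ‖ ^ 2) ^ (1/2 : ℝ)

/-- The restricted norm X^δ_{s,b}: infimum over Schwartz extensions off ℝⁿ × [0,δ]. -/
def XRNorm (n : ℕ) {E : Type*} [NormedAddCommGroup E] [NormedSpace ℂ E]
    (s b δ : ℝ) (f : Rn n → ℝ → E) : ℝ :=
  sInf { r : ℝ | ∃ ψ : SchwartzMap (Rn n × ℝ) E,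
    (∀ x : Rn n, ∀ t ∈ Icc (0:ℝ) δ, ψ (x, t) = f x t) ∧
    r = XNorm n s b (fun x t => ψ (x, t)) }

/-- Space-time L^p norm on ℝⁿ × ℝ. -/
def lpNormST (n : ℕ) {E : Type*} [NormedAddCommGroup E] (p : ℝ) (F : Rn n → ℝ → E) : ℝ :=
  (∫ t : ℝ, ∫ x : Rn n, ‖F x t‖ ^ p) ^ (1/p)

/-- Space-time L^p norm on ℝⁿ × [0,δ]. -/
def lpNormSTt (n : ℕ) {E : Type*} [NormedAddCommGroup E] (p δ : ℝ) (F : Rn n → ℝ → E) : ℝ :=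
  (∫ t in Icc (0:ℝ) δ, ∫ x : Rn n, ‖F x t‖ ^ p) ^ (1/p)

open scoped ENNReal SchwartzMap Convolution

lemma one_le_jap {n : ℕ} (ξ : Rn n) : 1 ≤ jap ξ :=
  Real.one_le_sqrt.2 (by nlinarith [sq_nonneg ‖ξ‖])

lemma one_le_japR (x : ℝ) : 1 ≤ japR x :=
  Real.one_le_sqrt.2 (by nlinarith [sq_nonneg x])

lemma jap_pos {n : ℕ} (ξ : Rn n) : 0 < jap ξ := zero_lt_one.trans_le (one_le_jap ξ)

lemma japR_pos (x : ℝ) : 0 < japR x := zero_lt_one.trans_le (one_le_japR x)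

lemma jap_rpow {n : ℕ} (ξ : Rn n) (r : ℝ) : jap ξ ^ r = (1 + ‖ξ‖ ^ 2) ^ (r / 2) := by
  rw [jap, Real.sqrt_eq_rpow, ← Real.rpow_mul (by positivity)]
  ring_nf

lemma japR_rpow (x : ℝ) (r : ℝ) : japR x ^ r = (1 + ‖x‖ ^ 2) ^ (r / 2) := by
  rw [japR, Real.sqrt_eq_rpow, ← Real.rpow_mul (by positivity), Real.norm_eq_abs, sq_abs]
  ring_nf

@[fun_prop]
lemma continuous_jap {n : ℕ} : Continuous (jap (n := n)) := by
  unfold jap; fun_prop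

@[fun_prop]
lemma continuous_japR : Continuous japR := by
  unfold japR; fun_prop

lemma integrable_japR_rpow {r : ℝ} (hr : 1 < r) : Integrable (fun x => japR x ^ (-r)) := by
  simp_rw [japR_rpow]
  exact integrable_rpow_neg_one_add_norm_sq (by simpa using hr)

lemma integrable_jap_rpow {n : ℕ} {r : ℝ} (hr : (n : ℝ) < r) :
    Integrable (fun ξ : Rn n => jap ξ ^ (-r)) := by
  simp_rw [jap_rpow]
  exact integrable_rpow_neg_one_add_norm_sq (by simpa using hr)

/-- In the plane, `|ξ|²` pushes Lebesgue measure forward to a multiple of Lebesgue measure on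
the half line. -/
lemma lintegral_norm_sq_le {f : ℝ → ℝ} (hf : Integrable f) (h0 : ∀ x, 0 ≤ f x) :
    ∫⁻ ξ : Rn 2, ENNReal.ofReal (f (‖ξ‖ ^ 2)) ≤
      ENNReal.ofReal (volume.real (Metric.ball (0 : Rn 2) 1) * ∫ y, f y) := by
  have hi : Integrable (fun ξ : Rn 2 => f (‖ξ‖ ^ 2)) := by
    rw [integrable_fun_norm_addHaar volume (f := fun r => f (r ^ 2))]
    have := (integrableOn_Ioi_comp_rpow_iff' f (p := 2) two_ne_zero).2 hf.integrableOn
    norm_num at this ⊢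
    exact this
  rw [← ofReal_integral_eq_lintegral_ofReal hi (.of_forall fun _ => h0 _),
    integral_fun_norm_addHaar volume (fun r => f (r ^ 2))]
  refine ENNReal.ofReal_le_ofReal ?_
  have := integral_comp_rpow_Ioi_of_pos (g := f) (p := 2) two_pos
  norm_num [mul_assoc, integral_const_mul] at this ⊢
  calc _ = volume.real (Metric.ball (0 : Rn 2) 1) * (2 * ∫ y in Ioi 0, y * f (y ^ 2)) := by ring
    _ ≤ _ := by
      rw [this]
      gcongr
      · exact .of_forall h0
      · exact Measure.restrict_le_self

lemma exists_lintegral_japR_le {a : ℝ} (ha : 1 < a) :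
    ∃ D : ℝ≥0∞, D ≠ ∞ ∧ ∀ (A : ℝ) (ξ₀ : Rn 2),
      ∫⁻ ξ : Rn 2, ENNReal.ofReal (japR (A - ‖ξ‖ ^ 2 - ‖ξ₀ - ξ‖ ^ 2) ^ (-a)) ≤ D := by
  refine ⟨_, ENNReal.ofReal_ne_top (r := volume.real (Metric.ball (0 : Rn 2) 1) *
    (2⁻¹ * ∫ y, japR y ^ (-a))), fun A ξ₀ => ?_⟩
  have key (ξ : Rn 2) : A - ‖ξ‖ ^ 2 - ‖ξ₀ - ξ‖ ^ 2 =
      (A - ‖ξ₀‖ ^ 2 / 2) - 2 * ‖ξ - (2⁻¹ : ℝ) • ξ₀‖ ^ 2 := by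
    simp only [@norm_sub_sq_real, norm_smul, inner_smul_right, mul_pow, real_inner_comm ξ ξ₀]
    norm_num
    ring
  simp_rw [key]
  rw [lintegral_sub_right_eq_self
    (fun ξ : Rn 2 => ENNReal.ofReal (japR ((A - ‖ξ₀‖ ^ 2 / 2) - 2 * ‖ξ‖ ^ 2) ^ (-a)))]
  have h1 := (integrable_japR_rpow ha).comp_sub_left (A - ‖ξ₀‖ ^ 2 / 2)
  refine (lintegral_norm_sq_le (f := fun y => japR ((A - ‖ξ₀‖ ^ 2 / 2) - 2 * y) ^ (-a))
    (h1.comp_mul_left' two_ne_zero) (fun _ => Real.rpow_nonneg (japR_pos _).le _)).trans_eq ?_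
  rw [Measure.integral_comp_mul_left (fun y => japR ((A - ‖ξ₀‖ ^ 2 / 2) - y) ^ (-a)),
    integral_sub_left_eq_self (fun y => japR y ^ (-a))]
  norm_num

/-- The Cauchy–Schwarz multiplier bound behind the bilinear `L²` estimate. -/
lemma exists_lintegral_weight_le {s b b' : ℝ} (hs : 1 / 2 < s) (hb : 1 / 2 < b)
    (hb' : 1 / 4 < b') :
    ∃ K : ℝ≥0∞, K ≠ ∞ ∧ ∀ (ξ₀ : Rn 2) (τ₀ : ℝ),
      ∫⁻ ξ : Rn 2, ∫⁻ τ : ℝ, ENNReal.ofReal (jap ξ ^ (-(2 * s)) *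
        japR (τ - ‖ξ‖ ^ 2) ^ (-(2 * b)) *
        japR (τ₀ - τ - ‖ξ₀ - ξ‖ ^ 2) ^ (-(2 * b'))) ≤ K := by
  obtain ⟨D, hD, hDle⟩ := exists_lintegral_japR_le (a := 4 * b') (by linarith)
  set B : ℝ≥0∞ := ∫⁻ σ : ℝ, ENNReal.ofReal (japR σ ^ (-(2 * b))) with hB
  have hBt : B ≠ ∞ := ((integrable_japR_rpow (r := 2 * b) (by linarith)).lintegral_lt_top).ne
  set A : ℝ≥0∞ := ∫⁻ ξ : Rn 2, ENNReal.ofReal (jap ξ ^ (-(4 * s))) with hA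
  have hAt : A ≠ ∞ :=
    ((integrable_jap_rpow (n := 2) (r := 4 * s) (by norm_num; linarith)).lintegral_lt_top).ne
  refine ⟨A * B + B * D, by finiteness, fun ξ₀ τ₀ => ?_⟩
  have hJ (σ r : ℝ) : 0 ≤ japR σ ^ r := Real.rpow_nonneg (japR_pos _).le _
  have hJ' (ξ : Rn 2) (r : ℝ) : 0 ≤ jap ξ ^ r := Real.rpow_nonneg (jap_pos _).le _
  have inner (ξ : Rn 2) : ∫⁻ τ : ℝ, ENNReal.ofReal (jap ξ ^ (-(2 * s)) *
        japR (τ - ‖ξ‖ ^ 2) ^ (-(2 * b)) *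
        japR (τ₀ - τ - ‖ξ₀ - ξ‖ ^ 2) ^ (-(2 * b'))) ≤
      ENNReal.ofReal (jap ξ ^ (-(4 * s))) * B + ∫⁻ σ : ℝ, ENNReal.ofReal (japR σ ^ (-(2 * b))) *
        ENNReal.ofReal (japR (τ₀ - σ - ‖ξ‖ ^ 2 - ‖ξ₀ - ξ‖ ^ 2) ^ (-(4 * b'))) := by
    rw [← lintegral_add_right_eq_self _ (‖ξ‖ ^ 2), hB, ← lintegral_const_mul _ (by fun_prop),
      ← lintegral_add_left (by fun_prop)]
    refine lintegral_mono fun σ => ?_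
    rw [← ENNReal.ofReal_mul (hJ _ _), ← ENNReal.ofReal_mul (hJ' _ _),
      ← ENNReal.ofReal_add (mul_nonneg (hJ' _ _) (hJ _ _)) (mul_nonneg (hJ _ _) (hJ _ _))]
    refine ENNReal.ofReal_le_ofReal ?_
    have e1 : jap ξ ^ (-(4 * s)) = (jap ξ ^ (-(2 * s))) ^ 2 := by
      rw [← Real.rpow_mul_natCast (jap_pos _).le]; norm_num; ring_nf
    have e2 (x : ℝ) : japR x ^ (-(4 * b')) = (japR x ^ (-(2 * b'))) ^ 2 := by
      rw [← Real.rpow_mul_natCast (japR_pos _).le]; norm_num; ring_nf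
    rw [e1, e2, add_sub_cancel_right, show τ₀ - (σ + ‖ξ‖ ^ 2) - ‖ξ₀ - ξ‖ ^ 2 =
      τ₀ - σ - ‖ξ‖ ^ 2 - ‖ξ₀ - ξ‖ ^ 2 by ring]
    have hx := hJ' ξ (-(2 * s))
    have hy := hJ (τ₀ - σ - ‖ξ‖ ^ 2 - ‖ξ₀ - ξ‖ ^ 2) (-(2 * b'))
    have hz := hJ σ (-(2 * b))
    generalize jap ξ ^ (-(2 * s)) = x at *
    generalize japR (τ₀ - σ - ‖ξ‖ ^ 2 - ‖ξ₀ - ξ‖ ^ 2) ^ (-(2 * b')) = y at *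
    generalize japR σ ^ (-(2 * b)) = z at *
    have : x * y ≤ x ^ 2 + y ^ 2 := by nlinarith [sq_nonneg (x - y), mul_nonneg hx hy]
    nlinarith [mul_le_mul_of_nonneg_left this hz]
  refine (lintegral_mono inner).trans ?_
  rw [lintegral_add_left (by fun_prop), lintegral_mul_const _ (by fun_prop)]
  gcongr
  rw [lintegral_lintegral_swap (by fun_prop)]
  calc _ ≤ ∫⁻ σ : ℝ, ENNReal.ofReal (japR σ ^ (-(2 * b))) * D := by
        refine lintegral_mono fun σ => ?_
        rw [lintegral_const_mul _ (by fun_prop)]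
        gcongr
        exact hDle _ _
    _ = B * D := lintegral_mul_const _ (by fun_prop)

/-- Young's inequality `L² * L² → L²` against a kernel with square-bounded sections. -/
lemma lintegral_sq_lintegral_mul_le {G : Type*} [AddCommGroup G] [MeasurableSpace G]
    [MeasurableAdd₂ G] [MeasurableNeg G] {μ : Measure G} [SFinite μ] [μ.IsAddRightInvariant]
    {k₁ k₂ F₁ F₂ : G → ℝ≥0∞} (hk₁ : Measurable k₁) (hk₂ : Measurable k₂)
    (hF₁ : Measurable F₁) (hF₂ : Measurable F₂) {K : ℝ≥0∞}
    (hK : ∀ z, ∫⁻ y, (k₁ y * k₂ (z - y)) ^ 2 ∂μ ≤ K) :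
    ∫⁻ z, (∫⁻ y, k₁ y * F₁ y * (k₂ (z - y) * F₂ (z - y)) ∂μ) ^ 2 ∂μ ≤
      K * ((∫⁻ y, F₁ y ^ 2 ∂μ) * ∫⁻ y, F₂ y ^ 2 ∂μ) := by
  have cs (z : G) : (∫⁻ y, k₁ y * F₁ y * (k₂ (z - y) * F₂ (z - y)) ∂μ) ^ 2 ≤
      K * ∫⁻ y, F₁ y ^ 2 * F₂ (z - y) ^ 2 ∂μ := by
    have h := ENNReal.lintegral_mul_le_Lp_mul_Lq μ Real.HolderConjugate.two_two
      (f := fun y => k₁ y * k₂ (z - y)) (g := fun y => F₁ y * F₂ (z - y))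
      (by fun_prop) (by fun_prop)
    calc _ ≤ _ := pow_le_pow_left' ((lintegral_congr fun y => by
            simp only [Pi.mul_apply]; ring).trans_le h) 2
      _ = (∫⁻ y, (k₁ y * k₂ (z - y)) ^ 2 ∂μ) * ∫⁻ y, F₁ y ^ 2 * F₂ (z - y) ^ 2 ∂μ := by
        rw [mul_pow, ← ENNReal.rpow_mul_natCast, ← ENNReal.rpow_mul_natCast]
        norm_num [mul_pow]
      _ ≤ _ := by gcongr; exact hK z
  refine (lintegral_mono cs).trans ?_
  rw [lintegral_const_mul _ (by fun_prop)]
  gcongr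
  rw [lintegral_lintegral_swap (by fun_prop)]
  refine le_of_eq ?_
  calc _ = ∫⁻ y, F₁ y ^ 2 * ∫⁻ z, F₂ z ^ 2 ∂μ ∂μ := by
        refine lintegral_congr fun y => ?_
        rw [lintegral_const_mul _ (by fun_prop), lintegral_sub_right_eq_self (fun z => F₂ z ^ 2)]
    _ = _ := lintegral_mul_const _ (by fun_prop)

lemma lintegral_mul_sq_le {α : Type*} [MeasurableSpace α] {μ : Measure α} {f g : α → ℝ≥0∞}
    (hf : AEMeasurable f μ) (hg : AEMeasurable g μ) :
    (∫⁻ x, f x * g x ∂μ) ^ 2 ≤ (∫⁻ x, f x ^ 2 ∂μ) * ∫⁻ x, g x ^ 2 ∂μ := by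
  have h := ENNReal.lintegral_mul_le_Lp_mul_Lq μ Real.HolderConjugate.two_two hf hg
  calc _ ≤ _ := pow_le_pow_left' h 2
    _ = _ := by
      rw [mul_pow, ← ENNReal.rpow_mul_natCast, ← ENNReal.rpow_mul_natCast]
      norm_num

/-- Space-time `ℝ² × ℝ` with its Euclidean structure. -/
abbrev SpaceTime := WithLp 2 (Rn 2 × ℝ)

lemma lintegral_spaceTime {f : SpaceTime → ℝ≥0∞} (hf : Measurable f) :
    ∫⁻ v, f v = ∫⁻ ξ : Rn 2, ∫⁻ τ : ℝ, f (WithLp.toLp 2 (ξ, τ)) := by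
  rw [← (WithLp.volume_preserving_toLp (Rn 2) ℝ).lintegral_comp hf, Measure.volume_eq_prod,
    lintegral_prod _ (by fun_prop)]

/-- The multiplier `⟨ξ⟩^s ⟨τ - |ξ|²⟩^b` defining `X_{s,b}`. -/
def xsbWeight (s b : ℝ) (v : SpaceTime) : ℝ := jap v.fst ^ s * japR (v.snd - ‖v.fst‖ ^ 2) ^ b

lemma xsbWeight_pos (s b : ℝ) (v : SpaceTime) : 0 < xsbWeight s b v :=
  mul_pos (Real.rpow_pos_of_pos (jap_pos _) _) (Real.rpow_pos_of_pos (japR_pos _) _)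

lemma continuous_xsbWeight (s b : ℝ) : Continuous (xsbWeight s b) := by
  refine .mul (.rpow_const (by fun_prop) fun v => .inl (jap_pos _).ne')
    (.rpow_const (by fun_prop) fun v => .inl (japR_pos _).ne')

lemma hasTemperateGrowth_xsbWeight (s b : ℝ) : (xsbWeight s b).HasTemperateGrowth := by
  have h1 : (fun v : SpaceTime => v.fst).HasTemperateGrowth :=
    (WithLp.fstL 2 ℝ (Rn 2) ℝ).hasTemperateGrowth
  have h2 : (fun v : SpaceTime => v.snd).HasTemperateGrowth :=
    (WithLp.sndL 2 ℝ (Rn 2) ℝ).hasTemperateGrowth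
  unfold xsbWeight
  simp_rw [jap_rpow, japR_rpow]
  refine ((Function.hasTemperateGrowth_one_add_norm_sq_rpow (Rn 2) (s / 2)).comp h1).mul
    ((Function.hasTemperateGrowth_one_add_norm_sq_rpow ℝ (b / 2)).comp
      (h2.sub ((Function.hasTemperateGrowth_norm_sq (Rn 2)).comp h1)))

/-- The `X_{s,b}` energy of a function, given through its space-time Fourier transform. -/
def xsbEnergy (s b : ℝ) (f : SpaceTime → ℂ) : ℝ≥0∞ :=
  ∫⁻ v, (ENNReal.ofReal (xsbWeight s b v) * ‖f v‖ₑ) ^ 2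

lemma exists_lintegral_convolution_sq_le {s b b' : ℝ} (hs : 1 / 2 < s) (hb : 1 / 2 < b)
    (hb' : 1 / 4 < b') :
    ∃ K : ℝ≥0∞, K ≠ ∞ ∧ ∀ f g : SpaceTime → ℂ, Continuous f → Continuous g →
      ∫⁻ z, ‖(f ⋆[ContinuousLinearMap.mul ℂ ℂ] g) z‖ₑ ^ 2 ≤
        K * (xsbEnergy s b f * xsbEnergy 0 b' g) := by
  obtain ⟨K, hK, hle⟩ := exists_lintegral_weight_le hs hb hb'
  refine ⟨K, hK, fun f g hf hg => ?_⟩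
  have hm (s b : ℝ) : Measurable (xsbWeight s b) := (continuous_xsbWeight s b).measurable
  have hf' := hf.measurable
  have hg' := hg.measurable
  have cancel (s b : ℝ) (v : SpaceTime) (a : ℝ≥0∞) : ENNReal.ofReal (xsbWeight (-s) (-b) v) *
      (ENNReal.ofReal (xsbWeight s b v) * a) = a := by
    rw [← mul_assoc, ← ENNReal.ofReal_mul (xsbWeight_pos _ _ _).le]
    have : xsbWeight (-s) (-b) v * xsbWeight s b v = 1 := by
      have h1 := (Real.rpow_pos_of_pos (jap_pos v.fst) s).ne'
      have h2 := (Real.rpow_pos_of_pos (japR_pos (v.snd - ‖v.fst‖ ^ 2)) b).ne'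
      simp only [xsbWeight, Real.rpow_neg (jap_pos _).le, Real.rpow_neg (japR_pos _).le]
      field_simp
    simp [this]
  have hmain := lintegral_sq_lintegral_mul_le (μ := (volume : Measure SpaceTime))
    (k₁ := fun v => ENNReal.ofReal (xsbWeight (-s) (-b) v))
    (k₂ := fun v => ENNReal.ofReal (xsbWeight (-0) (-b') v))
    (F₁ := fun v => ENNReal.ofReal (xsbWeight s b v) * ‖f v‖ₑ)
    (F₂ := fun v => ENNReal.ofReal (xsbWeight 0 b' v) * ‖g v‖ₑ) (K := K)
    (by fun_prop) (by fun_prop) (by fun_prop) (by fun_prop) ?_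
  · refine le_trans (lintegral_mono fun z => ?_) hmain
    gcongr
    simp only [cancel]
    refine (enorm_integral_le_lintegral_enorm _).trans_eq ?_
    simp
  · intro z
    rw [lintegral_spaceTime (by fun_prop)]
    refine le_of_eq_of_le ?_ (hle z.fst z.snd)
    refine lintegral_congr fun ξ => lintegral_congr fun τ => ?_
    rw [← ENNReal.ofReal_mul (xsbWeight_pos _ _ _).le,
      ← ENNReal.ofReal_pow (mul_pos (xsbWeight_pos _ _ _) (xsbWeight_pos _ _ _)).le]
    congr 1
    simp only [xsbWeight, WithLp.sub_fst, WithLp.sub_snd, neg_zero, Real.rpow_zero, one_mul,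
      mul_pow, ← Real.rpow_mul_natCast (jap_pos _).le, ← Real.rpow_mul_natCast (japR_pos _).le]
    norm_num [mul_comm]

lemma SchwartzMap.fourier_fourier_apply (w : 𝓢(SpaceTime, ℂ)) (z : SpaceTime) :
    (𝓕 (𝓕 w : 𝓢(SpaceTime, ℂ)) : 𝓢(SpaceTime, ℂ)) z = w (-z) := by
  conv_rhs => rw [← FourierTransform.fourierInv_fourier_eq (F := 𝓢(SpaceTime, ℂ)) w]
  rw [SchwartzMap.fourierInv_apply_eq]
  simp

lemma SchwartzMap.lintegral_enorm_sq (w : 𝓢(SpaceTime, ℂ)) :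
    ∫⁻ z, ‖w z‖ₑ ^ 2 = ENNReal.ofReal (∫ z, ‖w z‖ ^ 2) := by
  have hint : Integrable (fun z => ‖w z‖ ^ 2) :=
    (memLp_two_iff_integrable_sq_norm w.continuous.aestronglyMeasurable).1 (w.memLp 2)
  rw [ofReal_integral_eq_lintegral_ofReal hint (.of_forall fun _ => by positivity)]
  exact lintegral_congr fun z => by rw [ENNReal.ofReal_pow (norm_nonneg _), ofReal_norm]

/-- The bilinear Strichartz-type estimate `‖u v‖_{L²} ≲ ‖u‖_{X_{s,b}} ‖v‖_{X_{0,c}}`. -/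
lemma exists_lintegral_mul_sq_le {s b b' : ℝ} (hs : 1 / 2 < s) (hb : 1 / 2 < b)
    (hb' : 1 / 4 < b') :
    ∃ K : ℝ≥0∞, K ≠ ∞ ∧ ∀ u v : 𝓢(SpaceTime, ℂ),
      ∫⁻ z, (‖u z‖ₑ * ‖v z‖ₑ) ^ 2 ≤
        K * (xsbEnergy s b (𝓕 u : 𝓢(SpaceTime, ℂ)) * xsbEnergy 0 b' (𝓕 v : 𝓢(SpaceTime, ℂ))) := by
  obtain ⟨K, hK, hle⟩ := exists_lintegral_convolution_sq_le hs hb hb'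
  refine ⟨K, hK, fun u v => ?_⟩
  set c := SchwartzMap.convolution (ContinuousLinearMap.mul ℂ ℂ)
    (𝓕 u : 𝓢(SpaceTime, ℂ)) (𝓕 v : 𝓢(SpaceTime, ℂ)) with hc
  have h (z : SpaceTime) :
      (‖u (-z)‖ₑ * ‖v (-z)‖ₑ) ^ 2 = ‖(𝓕 c : 𝓢(SpaceTime, ℂ)) z‖ₑ ^ 2 := by
    rw [hc, SchwartzMap.fourier_convolution, SchwartzMap.pairing_apply_apply,
      SchwartzMap.fourier_fourier_apply, SchwartzMap.fourier_fourier_apply]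
    simp
  rw [← lintegral_neg_eq_self, lintegral_congr h, SchwartzMap.lintegral_enorm_sq,
    SchwartzMap.integral_norm_sq_fourier, ← SchwartzMap.lintegral_enorm_sq,
    lintegral_congr fun z => by rw [hc, SchwartzMap.convolution_apply]]
  exact hle _ _ (SchwartzMap.continuous _) (SchwartzMap.continuous _)

lemma integral_spaceTime_eq_integral_prod (f : SpaceTime → ℂ) :
    ∫ v, f v = ∫ p : Rn 2 × ℝ, f (WithLp.toLp 2 p) :=
  ((WithLp.volume_preserving_toLp (Rn 2) ℝ).integral_comp
    (MeasurableEquiv.toLp 2 (Rn 2 × ℝ)).measurableEmbedding f).symm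

lemma integrable_comp_toLp {f : SpaceTime → ℂ} (hf : Integrable f) :
    Integrable (fun p : Rn 2 × ℝ => f (WithLp.toLp 2 p)) :=
  (WithLp.volume_preserving_toLp (Rn 2) ℝ).integrable_comp_of_integrable hf

/-- A Schwartz function on the product `ℝ² × ℝ`, seen on the Euclidean space-time. -/
def SchwartzMap.toSpaceTime (φ : 𝓢(Rn 2 × ℝ, ℂ)) : 𝓢(SpaceTime, ℂ) :=
  SchwartzMap.compCLMOfContinuousLinearEquiv ℂ (WithLp.prodContinuousLinearEquiv 2 ℝ (Rn 2) ℝ) φ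

lemma SchwartzMap.toSpaceTime_apply (φ : 𝓢(Rn 2 × ℝ, ℂ)) (p : Rn 2 × ℝ) :
    φ.toSpaceTime (WithLp.toLp 2 p) = φ p := rfl

lemma integrable_cexp_mul_schwartzMap (φ : 𝓢(Rn 2 × ℝ, ℂ)) (ξ : Rn 2) (τ : ℝ) :
    Integrable (fun p : Rn 2 × ℝ =>
      cexp (I * ((-2 * Real.pi * (⟪p.1, ξ⟫ + p.2 * τ) : ℝ) : ℂ)) • φ p) := by
  refine (integrable_comp_toLp φ.toSpaceTime.integrable).bdd_mul (c := 1) ?_ ?_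
  · exact Continuous.aestronglyMeasurable (by fun_prop)
  · exact .of_forall fun p => by rw [mul_comm, norm_exp_ofReal_mul_I]

lemma fourier_toSpaceTime_apply (φ : 𝓢(Rn 2 × ℝ, ℂ)) (ξ : Rn 2) (τ : ℝ) :
    (𝓕 φ.toSpaceTime : 𝓢(SpaceTime, ℂ)) (WithLp.toLp 2 (ξ, τ)) =
      ∫ p : Rn 2 × ℝ, cexp (I * ((-2 * Real.pi * (⟪p.1, ξ⟫ + p.2 * τ) : ℝ) : ℂ)) • φ p := by
  rw [SchwartzMap.fourier_coe, Real.fourier_eq', integral_spaceTime_eq_integral_prod]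
  refine integral_congr_ae (.of_forall fun p => ?_)
  simp only [WithLp.prod_inner_apply, SchwartzMap.toSpaceTime_apply]
  congr 2
  simp [mul_comm]

lemma stFourier_eq (φ : 𝓢(Rn 2 × ℝ, ℂ)) (ξ : Rn 2) (τ : ℝ) :
    stFourier 2 (fun x t => φ (x, t)) ξ τ =
      (𝓕 φ.toSpaceTime : 𝓢(SpaceTime, ℂ)) (WithLp.toLp 2 (ξ, τ)) := by
  rw [fourier_toSpaceTime_apply, Measure.volume_eq_prod,
    integral_prod _ (integrable_cexp_mul_schwartzMap φ ξ τ)]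
  rfl

lemma ofReal_XNorm_sq (s b : ℝ) (φ : 𝓢(Rn 2 × ℝ, ℂ)) :
    ENNReal.ofReal (XNorm 2 s b fun x t => φ (x, t)) ^ 2 =
      xsbEnergy s b (𝓕 φ.toSpaceTime : 𝓢(SpaceTime, ℂ)) := by
  set W := SchwartzMap.smulLeftCLM ℂ (xsbWeight s b) (𝓕 φ.toSpaceTime : 𝓢(SpaceTime, ℂ)) with hW
  have hWa (v : SpaceTime) : W v = xsbWeight s b v • (𝓕 φ.toSpaceTime : 𝓢(SpaceTime, ℂ)) v :=
    SchwartzMap.smulLeftCLM_apply_apply (hasTemperateGrowth_xsbWeight s b) _ v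
  have hint : Integrable (fun v => ‖W v‖ ^ 2) :=
    (memLp_two_iff_integrable_sq_norm W.continuous.aestronglyMeasurable).1 (W.memLp 2)
  have hX : XNorm 2 s b (fun x t => φ (x, t)) = (∫ v, ‖W v‖ ^ 2) ^ (1 / 2 : ℝ) := by
    rw [XNorm]
    congr 1
    rw [← (WithLp.volume_preserving_toLp (Rn 2) ℝ).integral_comp
      (MeasurableEquiv.toLp 2 (Rn 2 × ℝ)).measurableEmbedding, Measure.volume_eq_prod,
      integral_prod (fun p : Rn 2 × ℝ => ‖W (WithLp.toLp 2 p)‖ ^ 2)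
        ((WithLp.volume_preserving_toLp (Rn 2) ℝ).integrable_comp_of_integrable hint)]
    congr! with ξ τ
    rw [stFourier_eq, hWa, norm_smul, mul_pow, Real.norm_of_nonneg (xsbWeight_pos _ _ _).le]
    congr 1
    rw [xsbWeight, mul_pow, ← Real.rpow_mul_natCast (jap_pos _).le,
      ← Real.rpow_mul_natCast (japR_pos _).le]
    norm_num [mul_comm]
  have h0 : 0 ≤ ∫ v, ‖W v‖ ^ 2 := integral_nonneg fun _ => by positivity
  rw [hX, ← ENNReal.ofReal_pow (Real.rpow_nonneg h0 _), ← Real.rpow_mul_natCast h0]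
  norm_num
  rw [← SchwartzMap.lintegral_enorm_sq, xsbEnergy]
  refine lintegral_congr fun v => ?_
  rw [hWa, enorm_smul, Real.enorm_of_nonneg (xsbWeight_pos _ _ _).le]

lemma SchwartzMap.exists_norm_le_rpow {E : Type*} [NormedAddCommGroup E] [NormedSpace ℝ E]
    (f : 𝓢(E, ℂ)) (k : ℕ) : ∃ C : ℝ, 0 ≤ C ∧ ∀ x, ‖f x‖ ≤ C * (1 + ‖x‖) ^ (-(k : ℝ)) := by
  refine ⟨2 ^ k * ((Finset.Iic (k, 0)).sup fun m => SchwartzMap.seminorm ℝ m.1 m.2) f,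
    by positivity, fun x => ?_⟩
  have h := SchwartzMap.one_add_le_sup_seminorm_apply (𝕜 := ℝ) (m := (k, 0)) le_rfl le_rfl f x
  rw [norm_iteratedFDeriv_zero] at h
  rw [Real.rpow_neg (by positivity), Real.rpow_natCast, ← div_eq_mul_inv,
    le_div_iff₀ (by positivity), mul_comm]
  exact h

lemma rpow_neg_natCast_le {a b : ℝ} (ha : 0 ≤ a) (hab : a ≤ b) (k : ℕ) :
    (1 + b) ^ (-(k : ℝ)) ≤ (1 + a) ^ (-(k : ℝ)) :=
  Real.rpow_le_rpow_of_nonpos (by positivity) (by linarith) (by simp)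

/-- Inverting only in time the space-time Fourier transform leaves the spatial one. -/
lemma integral_cexp_mul_fourier_toSpaceTime (φ : 𝓢(Rn 2 × ℝ, ℂ)) (ξ : Rn 2) (t : ℝ) :
    ∫ τ : ℝ, cexp ((2 * Real.pi * (τ * t) : ℝ) * I) •
      (𝓕 φ.toSpaceTime : 𝓢(SpaceTime, ℂ)) (WithLp.toLp 2 (ξ, τ)) =
    𝓕 (fun y => φ (y, t)) ξ := by
  set g : ℝ → ℂ := fun t => 𝓕 (fun y => φ (y, t)) ξ with hg
  have hge (t : ℝ) : g t = ∫ y : Rn 2, cexp ((-2 * Real.pi * ⟪y, ξ⟫ : ℝ) * I) • φ (y, t) :=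
    Real.fourier_eq' _ _
  have hφ (p : Rn 2 × ℝ) (τ : ℝ) : cexp (I * ((-2 * Real.pi * (⟪p.1, ξ⟫ + p.2 * τ) : ℝ) : ℂ)) • φ p
      = cexp ((-2 * Real.pi * (p.2 * τ) : ℝ) * I) •
        (cexp ((-2 * Real.pi * ⟪p.1, ξ⟫ : ℝ) * I) • φ p) := by
    rw [smul_smul, ← Complex.exp_add]
    congr 2
    push_cast
    ring
  have hgc : Continuous g := by
    obtain ⟨C, hC0, hC⟩ := φ.exists_norm_le_rpow 3
    simp_rw [funext hge]
    refine continuous_of_dominated (bound := fun y => C * (1 + ‖y‖) ^ (-((3 : ℕ) : ℝ)))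
      (fun t => Continuous.aestronglyMeasurable (by fun_prop)) (fun t => .of_forall fun y => ?_)
      ((integrable_one_add_norm (by simp; norm_num)).const_mul C)
      (.of_forall fun y => by fun_prop)
    rw [norm_smul, norm_exp_ofReal_mul_I, one_mul]
    refine (hC _).trans ?_
    exact mul_le_mul_of_nonneg_left
      (rpow_neg_natCast_le (norm_nonneg y) (norm_fst_le (y, t)) 3) hC0
  have hgi : Integrable g := by
    have := (integrable_cexp_mul_schwartzMap φ ξ 0)
    simp_rw [hφ] at this
    refine this.integral_prod_right.congr (.of_forall fun t => ?_)
    simp [hge]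
  have hgF (τ : ℝ) : 𝓕 g τ =
      (𝓕 φ.toSpaceTime : 𝓢(SpaceTime, ℂ)) (WithLp.toLp 2 (ξ, τ)) := by
    rw [fourier_toSpaceTime_apply, Real.fourier_eq', Measure.volume_eq_prod,
      integral_prod_symm _ (integrable_cexp_mul_schwartzMap φ ξ τ)]
    refine integral_congr_ae (.of_forall fun t => ?_)
    simp only [fun y : Rn 2 => hφ (y, t) τ]
    rw [integral_smul, hge]
    simp [mul_comm]
  have hFi : Integrable (𝓕 g) := by
    obtain ⟨C, hC0, hC⟩ := (𝓕 φ.toSpaceTime : 𝓢(SpaceTime, ℂ)).exists_norm_le_rpow 2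
    rw [funext hgF]
    refine Integrable.mono' ((integrable_one_add_norm (r := ((2 : ℕ) : ℝ)) (by simp)).const_mul C)
      (Continuous.aestronglyMeasurable (by fun_prop)) (.of_forall fun τ => (hC _).trans ?_)
    exact mul_le_mul_of_nonneg_left
      (rpow_neg_natCast_le (norm_nonneg τ) (WithLp.norm_snd_le _ (WithLp.toLp 2 (ξ, τ))) 2) hC0
  have := congr_fun (hgc.fourierInv_fourier_eq hgi hFi) t
  rw [Real.fourierInv_eq'] at this
  rw [show 𝓕 (fun y => φ (y, t)) ξ = g t from rfl, ← this]
  simp [hgF, mul_comm]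

/-- `⟨∇⟩^s φ` on space-time. -/
def SchwartzMap.japMulST (s : ℝ) (φ : 𝓢(Rn 2 × ℝ, ℂ)) : 𝓢(SpaceTime, ℂ) :=
  𝓕⁻ (SchwartzMap.smulLeftCLM ℂ (xsbWeight s 0) (𝓕 φ.toSpaceTime : 𝓢(SpaceTime, ℂ)))

lemma SchwartzMap.japMulST_apply (s : ℝ) (φ : 𝓢(Rn 2 × ℝ, ℂ)) (x : Rn 2) (t : ℝ) :
    φ.japMulST s (WithLp.toLp 2 (x, t)) = japMul 2 s (fun y => φ (y, t)) x := by
  set W := SchwartzMap.smulLeftCLM ℂ (xsbWeight s 0) (𝓕 φ.toSpaceTime : 𝓢(SpaceTime, ℂ)) with hW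
  have hWa (v : SpaceTime) : W v = xsbWeight s 0 v • (𝓕 φ.toSpaceTime : 𝓢(SpaceTime, ℂ)) v :=
    SchwartzMap.smulLeftCLM_apply_apply (hasTemperateGrowth_xsbWeight s 0) _ v
  have hi : Integrable (fun p : Rn 2 × ℝ =>
      cexp ((2 * Real.pi * inner ℝ (WithLp.toLp 2 p : SpaceTime) (WithLp.toLp 2 (x, t)) : ℝ) * I) •
        W (WithLp.toLp 2 p)) := by
    refine (integrable_comp_toLp W.integrable).bdd_mul (c := 1) ?_ ?_
    · exact Continuous.aestronglyMeasurable (by fun_prop)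
    · exact .of_forall fun p => by rw [norm_exp_ofReal_mul_I]
  rw [SchwartzMap.japMulST, SchwartzMap.fourierInv_coe, ← hW, Real.fourierInv_eq',
    integral_spaceTime_eq_integral_prod, Measure.volume_eq_prod, integral_prod _ hi, japMul,
    Real.fourierInv_eq']
  refine integral_congr_ae (.of_forall fun ξ => ?_)
  simp only
  rw [← integral_cexp_mul_fourier_toSpaceTime, smul_eq_mul, ← integral_const_mul,
    ← integral_const_mul]
  refine integral_congr_ae (.of_forall fun τ => ?_)
  simp only [hWa, xsbWeight, Real.rpow_zero, mul_one, WithLp.prod_inner_apply, smul_eq_mul,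
    Complex.real_smul, mul_add, Complex.ofReal_add, add_mul, Complex.exp_add, RCLike.inner_apply,
    conj_trivial]
  change _ * _ * (((jap ξ ^ s : ℝ) : ℂ) * _) = _
  rw [mul_comm τ t]
  ring

lemma xsbEnergy_japMulST (s b : ℝ) (φ : 𝓢(Rn 2 × ℝ, ℂ)) :
    xsbEnergy 0 b (𝓕 (φ.japMulST s) : 𝓢(SpaceTime, ℂ)) =
      xsbEnergy s b (𝓕 φ.toSpaceTime : 𝓢(SpaceTime, ℂ)) := by
  refine lintegral_congr fun v => ?_
  rw [SchwartzMap.japMulST, FourierTransform.fourier_fourierInv_eq,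
    SchwartzMap.smulLeftCLM_apply_apply (hasTemperateGrowth_xsbWeight s 0), enorm_smul,
    Real.enorm_of_nonneg (xsbWeight_pos _ _ _).le, ← mul_assoc,
    ← ENNReal.ofReal_mul (xsbWeight_pos _ _ _).le]
  simp [xsbWeight, mul_comm]

lemma xsbEnergy_mono {s b b' : ℝ} (h : b' ≤ b) (f : SpaceTime → ℂ) :
    xsbEnergy s b' f ≤ xsbEnergy s b f := by
  refine lintegral_mono fun v => ?_
  unfold xsbWeight
  have := Real.rpow_le_rpow_of_exponent_le (one_le_japR (v.snd - ‖v.fst‖ ^ 2)) h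
  have := (jap_pos v.fst).le
  gcongr

lemma XNorm_nonneg (n : ℕ) (s b : ℝ) (ψ : Rn n → ℝ → ℂ) : 0 ≤ XNorm n s b ψ :=
  Real.rpow_nonneg (integral_nonneg fun _ => integral_nonneg fun _ =>
    mul_nonneg (mul_nonneg (Real.rpow_nonneg (jap_pos _).le _)
      (Real.rpow_nonneg (japR_pos _).le _)) (sq_nonneg _)) _

/-- Dual quadrilinear estimate in ℝ^{2+1}. -/
theorem statement_9 :
    ∀ s : ℝ, 4/7 < s → s < 1 →
    ∃ ε₀ > (0:ℝ), ∀ ε : ℝ, 0 < ε → ε < ε₀ →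
    ∃ C > (0:ℝ), ∀ φ₁ φ₂ φ₃ φ₄ : SchwartzMap (Rn 2 × ℝ) ℂ,
    ‖∫ t : ℝ, ∫ x : Rn 2,
        japMul 2 s (fun y => φ₁ (y, t)) x * (starRingEnd ℂ) (φ₂ (x, t)) *
          φ₃ (x, t) * φ₄ (x, t)‖
      ≤ C * XNorm 2 s (1/2 + ε) (fun x t => φ₁ (x, t)) *
          XNorm 2 s (1/2 + ε) (fun x t => φ₂ (x, t)) *
          XNorm 2 s (1/2 + ε) (fun x t => φ₃ (x, t)) *
          XNorm 2 0 (1/2 - 2 * ε) (fun x t => φ₄ (x, t)) := by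
  intro s hs _
  refine ⟨1 / 8, by norm_num, fun ε hε hε' => ?_⟩
  obtain ⟨K, hK, hle⟩ := exists_lintegral_mul_sq_le (s := s) (b := 1 / 2 + ε)
    (b' := 1 / 2 - 2 * ε) (by linarith) (by linarith) (by linarith)
  refine ⟨K.toReal + 1, by positivity, fun φ₁ φ₂ φ₃ φ₄ => ?_⟩
  set X₁ := XNorm 2 s (1 / 2 + ε) fun x t => φ₁ (x, t) with hX₁
  set X₂ := XNorm 2 s (1 / 2 + ε) fun x t => φ₂ (x, t) with hX₂
  set X₃ := XNorm 2 s (1 / 2 + ε) fun x t => φ₃ (x, t) with hX₃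
  set X₄ := XNorm 2 0 (1 / 2 - 2 * ε) fun x t => φ₄ (x, t) with hX₄
  have h₁ : 0 ≤ X₁ := XNorm_nonneg _ _ _ _
  have h₂ : 0 ≤ X₂ := XNorm_nonneg _ _ _ _
  have h₃ : 0 ≤ X₃ := XNorm_nonneg _ _ _ _
  have h₄ : 0 ≤ X₄ := XNorm_nonneg _ _ _ _
  have hpair₁ := hle φ₃.toSpaceTime (φ₁.japMulST s)
  have hpair₂ := hle φ₂.toSpaceTime φ₄.toSpaceTime
  have hmono := xsbEnergy_mono (s := 0) (b := 1 / 2 + ε) (b' := 1 / 2 - 2 * ε) (by linarith)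
    (𝓕 (φ₁.japMulST s) : 𝓢(SpaceTime, ℂ))
  rw [xsbEnergy_japMulST s (1 / 2 + ε), ← ofReal_XNorm_sq, ← hX₁] at hmono
  rw [← ofReal_XNorm_sq, ← hX₃] at hpair₁
  rw [← ofReal_XNorm_sq, ← ofReal_XNorm_sq, ← hX₂, ← hX₄] at hpair₂
  have hsq : (∫⁻ v, (‖φ₃.toSpaceTime v‖ₑ * ‖φ₁.japMulST s v‖ₑ) *
      (‖φ₂.toSpaceTime v‖ₑ * ‖φ₄.toSpaceTime v‖ₑ)) ^ 2 ≤
      (K * ENNReal.ofReal X₁ * ENNReal.ofReal X₂ * ENNReal.ofReal X₃ * ENNReal.ofReal X₄) ^ 2 :=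
    calc _ ≤ _ := lintegral_mul_sq_le (by fun_prop) (by fun_prop)
      _ ≤ _ := mul_le_mul' (hpair₁.trans (mul_le_mul_right (mul_le_mul_right hmono _) _)) hpair₂
      _ = _ := by ring
  have henorm : ‖∫ t : ℝ, ∫ x : Rn 2,
        japMul 2 s (fun y => φ₁ (y, t)) x * (starRingEnd ℂ) (φ₂ (x, t)) *
          φ₃ (x, t) * φ₄ (x, t)‖ₑ ≤
      ∫⁻ v, (‖φ₃.toSpaceTime v‖ₑ * ‖φ₁.japMulST s v‖ₑ) *
        (‖φ₂.toSpaceTime v‖ₑ * ‖φ₄.toSpaceTime v‖ₑ) := by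
    rw [lintegral_spaceTime (by fun_prop), lintegral_lintegral_swap (by fun_prop)]
    refine (enorm_integral_le_lintegral_enorm _).trans (lintegral_mono fun t =>
      (enorm_integral_le_lintegral_enorm _).trans_eq (lintegral_congr fun x => ?_))
    simp only [SchwartzMap.toSpaceTime_apply, SchwartzMap.japMulST_apply, enorm_mul,
      RCLike.enorm_conj]
    ring
  have hfin := henorm.trans ((ENNReal.pow_le_pow_left_iff two_ne_zero).1 hsq)
  rw [← ENNReal.ofReal_toReal hK, ← ENNReal.ofReal_mul (by positivity),
    ← ENNReal.ofReal_mul (by positivity), ← ENNReal.ofReal_mul (by positivity),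
    ← ENNReal.ofReal_mul (by positivity), ← ofReal_norm,
    ENNReal.ofReal_le_ofReal_iff (by positivity)] at hfin
  refine hfin.trans ?_
  gcongr
  linarith

end
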